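/- If v is a unit of O_L with τ(v)·v = 1 and v > 1 (as a real number, via the inclusion L ⊂ ℝ), then v ≥ (1 + √2) + (1 + √2)·α as real numbers. -/

import Mathlib

open IntermediateField Polynomial

noncomputable def alpha : ℝ := (2 : ℝ) ^ ((1 : ℝ) / 4)

noncomputable def L : IntermediateField ℚ ℝ := ℚ⟮alpha⟯

noncomputable def alphaL : L := ⟨alpha, IntermediateField.mem_adjoin_simple_self ℚ alpha⟩

lemma alpha_pos : 0 < alpha := by unfold alpha; positivity

lemma alpha_sq : alpha ^ 2 = √2 := by
  unfold alpha
  rw [← Real.rpow_natCast, ← Real.rpow_mul (by norm_num), Real.sqrt_eq_rpow]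
  norm_num

lemma sqrt_two_sq : √2 * √2 = (2 : ℝ) := Real.mul_self_sqrt (by norm_num)

lemma alpha_four : alpha ^ 4 = 2 := by
  have : alpha ^ 4 = alpha ^ 2 * alpha ^ 2 := by ring
  rw [this, alpha_sq, sqrt_two_sq]

lemma alpha_integral : IsIntegral ℚ alpha :=
  ⟨X ^ 4 - C 2, monic_X_pow_sub_C _ (by norm_num), by simp [alpha_four]⟩

/-- Rational coordinates in the basis 1, α, α², α³. -/
lemma exists_coords (x : ℝ) (hx : x ∈ L) : ∃ p q r s : ℚ,
    x = p + q * alpha + r * alpha ^ 2 + s * alpha ^ 3 := by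
  have hx' : x ∈ Algebra.adjoin ℚ {alpha} := by
    rw [← IntermediateField.adjoin_simple_toSubalgebra_of_isAlgebraic
      alpha_integral.isAlgebraic]
    exact hx
  clear hx
  induction hx' using Algebra.adjoin_induction with
  | mem x hx =>
    rw [Set.mem_singleton_iff] at hx
    exact ⟨0, 1, 0, 0, by simp [hx]⟩
  | algebraMap c => exact ⟨c, 0, 0, 0, by simp⟩
  | add x y hx hy h1 h2 =>
    obtain ⟨p, q, r, s, h⟩ := h1
    obtain ⟨p', q', r', s', h'⟩ := h2
    refine ⟨p + p', q + q', r + r', s + s', ?_⟩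
    rw [h, h']; push_cast; ring
  | mul x y hx hy h1 h2 =>
    obtain ⟨p, q, r, s, h⟩ := h1
    obtain ⟨p', q', r', s', h'⟩ := h2
    refine ⟨p * p' + 2 * (q * s' + r * r' + s * q'), p * q' + q * p' + 2 * (r * s' + s * r'),
      p * r' + q * q' + r * p' + 2 * s * s', p * s' + q * r' + r * q' + s * p', ?_⟩
    rw [h, h']; push_cast
    linear_combination ((q : ℝ) * s' + r * r' + s * q' + (r * s' + s * r') * alpha
      + s * s' * alpha ^ 2) * alpha_four

lemma sqrt_two_indep (a b : ℚ) (h : (a : ℝ) + b * √2 = 0) : a = 0 ∧ b = 0 := by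
  have hb : b = 0 := by
    by_contra hb
    apply irrational_sqrt_two
    refine ⟨-a / b, ?_⟩
    have : (b : ℝ) ≠ 0 := by exact_mod_cast hb
    push_cast
    field_simp
    linarith
  subst hb
  simpa using h

lemma conj_integral (x y : ℚ) (h : IsIntegral ℤ ((x : ℝ) + y * √2)) :
    IsIntegral ℤ ((x : ℝ) - y * √2) := by
  obtain ⟨P, hP, h0⟩ := h
  refine ⟨P, hP, ?_⟩
  have key : ∀ P : ℤ[X], ∃ A B : ℚ, P.eval₂ (algebraMap ℤ ℝ) ((x : ℝ) + y * √2) = A + B * √2 ∧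
      P.eval₂ (algebraMap ℤ ℝ) ((x : ℝ) - y * √2) = A - B * √2 := by
    intro P
    induction P using Polynomial.induction_on with
    | C a => exact ⟨a, 0, by rw [eval₂_C]; simp, by rw [eval₂_C]; simp⟩
    | add p q h1 h2 =>
      obtain ⟨A, B, h3, h4⟩ := h1
      obtain ⟨A', B', h3', h4'⟩ := h2
      refine ⟨A + A', B + B', ?_, ?_⟩
      · rw [eval₂_add, h3, h3']; push_cast; ring
      · rw [eval₂_add, h4, h4']; push_cast; ring
    | monomial n a h =>
      obtain ⟨A, B, h1, h2⟩ := h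
      refine ⟨A * x + 2 * B * y, A * y + B * x, ?_, ?_⟩
      · rw [pow_succ, ← mul_assoc, eval₂_mul, h1, eval₂_X]; push_cast
        linear_combination (B : ℝ) * y * sqrt_two_sq
      · rw [pow_succ, ← mul_assoc, eval₂_mul, h2, eval₂_X]; push_cast
        linear_combination (B : ℝ) * y * sqrt_two_sq
  obtain ⟨A, B, h1, h2⟩ := key P
  obtain ⟨rfl, rfl⟩ := sqrt_two_indep A B (by rw [← h1]; exact h0)
  rw [h2]; simp

lemma rat_integral (c : ℚ) (h : IsIntegral ℤ (c : ℝ)) : ∃ n : ℤ, (n : ℚ) = c := by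
  have h' : IsIntegral ℤ (algebraMap ℚ ℝ c) := by simpa using h
  rw [isIntegral_algebraMap_iff (algebraMap ℚ ℝ).injective] at h'
  obtain ⟨n, hn⟩ := IsIntegrallyClosed.isIntegral_iff.mp h'
  exact ⟨n, by simpa using hn⟩

lemma rat_of_sq (c : ℚ) (m : ℤ) (h : c ^ 2 = m) : ∃ n : ℤ, (n : ℚ) = c := by
  have : IsIntegral ℤ c := by
    apply IsIntegral.of_pow (n := 2) (by norm_num)
    rw [h]
    exact isIntegral_algebraMap (R := ℤ) (A := ℚ) (x := m)
  obtain ⟨n, hn⟩ := IsIntegrallyClosed.isIntegral_iff.mp this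
  exact ⟨n, by simpa using hn⟩

lemma coords_int (x y : ℚ) (h : IsIntegral ℤ ((x : ℝ) + y * √2)) :
    ∃ m n : ℤ, (m : ℚ) = x ∧ (n : ℚ) = y := by
  have h' := conj_integral x y h
  obtain ⟨a, ha⟩ := rat_integral (2 * x) (by
    have := h.add h'
    have e : ((2 * x : ℚ) : ℝ) = (x + y * √2) + (x - y * √2) := by push_cast; ring
    rwa [e])
  obtain ⟨b, hb⟩ := rat_integral (x ^ 2 - 2 * y ^ 2) (by
    have := h.mul h'
    have e : ((x ^ 2 - 2 * y ^ 2 : ℚ) : ℝ) = (x + y * √2) * (x - y * √2) := by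
      push_cast
      linear_combination (y : ℝ) ^ 2 * sqrt_two_sq
    rwa [e])
  -- 2 * (2y)^2 = a^2 - 4b
  obtain ⟨c, hc⟩ := rat_of_sq (4 * y) (2 * (a ^ 2 - 4 * b)) (by
    push_cast; rw [ha, hb]; ring)
  have e : c ^ 2 = 2 * (a ^ 2 - 4 * b) := by
    have : (c : ℚ) ^ 2 = 2 * (a ^ 2 - 4 * b) := by rw [ha, hb, hc]; ring
    exact_mod_cast this
  have c2 : (2 : ℤ) ∣ c := Int.prime_two.dvd_of_dvd_pow ⟨_, e⟩
  obtain ⟨c, rfl⟩ := c2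
  have e2 : a ^ 2 = 2 * (c ^ 2 + 2 * b) := by linarith
  have a2 : (2 : ℤ) ∣ a := Int.prime_two.dvd_of_dvd_pow ⟨_, e2⟩
  obtain ⟨a, rfl⟩ := a2
  have e3 : c ^ 2 = 2 * (a ^ 2 - b) := by linarith
  have c3 : (2 : ℤ) ∣ c := Int.prime_two.dvd_of_dvd_pow ⟨_, e3⟩
  obtain ⟨c, rfl⟩ := c3
  refine ⟨a, c, ?_, ?_⟩
  · push_cast at ha; linarith
  · push_cast at hc; linarith

lemma not_sq (w : ℚ) (m k : ℤ) (hk : 0 ≤ k) (h1 : k ^ 2 < m) (h2 : m < (k + 1) ^ 2)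
    (h : w ^ 2 = m) : False := by
  obtain ⟨n, rfl⟩ := rat_of_sq w m h
  have h : n ^ 2 = m := by exact_mod_cast h
  rw [← h] at h1 h2
  have h3 := abs_lt_of_sq_lt_sq h2 (by omega)
  have h4 := lt_of_pow_lt_pow_left₀ 2 (abs_nonneg n) (by rwa [sq_abs] : k ^ 2 < |n| ^ 2)
  omega

theorem stmt3 (τ : L ≃ₐ[ℚ] L) (hτ : τ alphaL = -alphaL) (v : L)
    (hvint : IsIntegral ℤ v) (hvunit : ∃ w : L, IsIntegral ℤ w ∧ v * w = 1)
    (hτv : τ v * v = 1) (hv1 : 1 < (v : ℝ)) :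
    (1 + alpha ^ 2) + (1 + alpha ^ 2) * alpha ≤ (v : ℝ) := by
  by_contra! hlt
  obtain ⟨p, q, r, s, hv⟩ := exists_coords v v.2
  have hvL : v = (p : L) + q * alphaL + r * alphaL ^ 2 + s * alphaL ^ 3 := by
    apply Subtype.ext
    rw [hv]
    simp [alphaL]
  have hτL : τ v = (p : L) - q * alphaL + r * alphaL ^ 2 - s * alphaL ^ 3 := by
    rw [hvL]
    simp only [map_add, map_mul, map_pow, map_ratCast, hτ]
    ring
  have hu : ((τ v : L) : ℝ) = p - q * alpha + r * alpha ^ 2 - s * alpha ^ 3 := by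
    rw [hτL]
    simp [alphaL]
  have hmul : ((τ v : L) : ℝ) * (v : ℝ) = 1 := by
    have := congrArg (fun z : L => (z : ℝ)) hτv
    simpa using this
  have hint : IsIntegral ℤ (((τ v : L) : ℝ) + (v : ℝ)) := by
    have h1 : IsIntegral ℤ (τ v + v) := (hvint.map τ).add hvint
    have := h1.map (L.val)
    simpa using this
  generalize ((τ v : L) : ℝ) = u at *
  generalize (v : ℝ) = V at *
  have ha := alpha_sq
  have ha3 : alpha ^ 3 = √2 * alpha := by rw [← ha]; ring
  have hs2 := sqrt_two_sq
  have hsum : u + V = ((2 * p : ℚ) : ℝ) + ((2 * r : ℚ) : ℝ) * √2 := by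
    rw [hu, hv, ha]; push_cast; ring
  rw [hsum] at hint
  obtain ⟨x, y, hx, hy⟩ := coords_int _ _ hint
  have hrel : ((p ^ 2 + 2 * r ^ 2 - 4 * q * s - 1 : ℚ) : ℝ)
      + ((2 * p * r - q ^ 2 - 2 * s ^ 2 : ℚ) : ℝ) * √2 = 0 := by
    rw [hu, hv, ha3, ha] at hmul
    push_cast
    linear_combination hmul + ((q : ℝ) + s * √2) ^ 2 * ha
      + (2 * (q : ℝ) * s + s ^ 2 * √2 - r ^ 2) * hs2
  obtain ⟨e1, e2⟩ := sqrt_two_indep _ _ hrel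
  have hp : p = x / 2 := by rw [hx]; ring
  have hr : r = y / 2 := by rw [hy]; ring
  have hnorm : ((x : ℚ) ^ 2 + 2 * y ^ 2 - 4) ^ 2 - 8 * x ^ 2 * y ^ 2
      = -2 * (4 * q ^ 2 - 8 * s ^ 2) ^ 2 := by
    have f1 : (x : ℚ) ^ 2 + 2 * y ^ 2 - 4 = 16 * q * s := by
      rw [hp, hr] at e1; linarith
    have f2 : (x : ℚ) * y = 2 * q ^ 2 + 4 * s ^ 2 := by
      rw [hp, hr] at e2; linarith
    have : 8 * (x : ℚ) ^ 2 * y ^ 2 = 8 * ((x : ℚ) * y) ^ 2 := by ring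
    rw [this, f1, f2]; ring
  -- the conjugate bound
  have hconj : ((x : ℝ) - y * √2) ^ 2 ≤ 4 := by
    have e1' : (p : ℝ) ^ 2 + 2 * r ^ 2 - 4 * q * s - 1 = 0 := by exact_mod_cast e1
    have e2' : 2 * (p : ℝ) * r - q ^ 2 - 2 * s ^ 2 = 0 := by exact_mod_cast e2
    have hx' : (x : ℝ) = 2 * p := by exact_mod_cast hx
    have hy' : (y : ℝ) = 2 * r := by exact_mod_cast hy
    have key : ((x : ℝ) - y * √2) ^ 2 = 4 - 4 * (√2 * (q - s * √2) ^ 2) := by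
      rw [hx', hy']
      linear_combination 4 * e1' - 4 * √2 * e2'
        + (4 * (r : ℝ) ^ 2 - 8 * q * s + 4 * s ^ 2 * √2) * hs2
    have : 0 ≤ √2 * ((q : ℝ) - s * √2) ^ 2 := by positivity
    linarith
  have hsl : (1.4142 : ℝ) < √2 := Real.lt_sqrt_of_sq_lt (by norm_num)
  have hsu : √2 < (1.41422 : ℝ) := by
    rw [Real.sqrt_lt' (by norm_num)]; norm_num
  have hau : alpha < 1.1893 := by
    apply lt_of_pow_lt_pow_left₀ 2 (by norm_num)
    rw [ha]; norm_num; linarith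
  have hV : V < 5.29 := by
    rw [ha] at hlt
    nlinarith [alpha_pos]
  have hsum' : u + V = x + y * √2 := by
    rw [hsum, ← hx, ← hy]; push_cast; rfl
  have hlow : 2 < (x : ℝ) + y * √2 := by
    rw [← hsum']
    by_contra! hc
    nlinarith
  have hup : (x : ℝ) + y * √2 < 5.48 := by
    rw [← hsum']
    by_contra! hc
    nlinarith
  obtain ⟨hc1, hc2⟩ := abs_le.mp (abs_le_of_sq_le_sq (by linarith : ((x : ℝ) - y * √2) ^ 2 ≤ 2 ^ 2) (by norm_num))
  have hy0 : 0 < y := by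
    have : (0 : ℝ) < y := by
      by_contra! hc
      nlinarith
    exact_mod_cast this
  have hy3 : y < 3 := by
    have : (y : ℝ) < 3 := by
      by_contra! hc
      nlinarith
    exact_mod_cast this
  have hx0 : 0 < x := by
    interval_cases y
    all_goals
      push_cast at *
      have : (0 : ℝ) < x := by linarith
      exact_mod_cast this
  have hx4 : x < 4 := by
    interval_cases y
    all_goals
      push_cast at *
      have : (x : ℝ) < 4 := by linarith
      exact_mod_cast this
  have hx3 : y = 2 → x < 3 := by
    rintro rfl
    push_cast at *
    have : (x : ℝ) < 3 := by linarith
    exact_mod_cast this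
  clear hx hy hp hr hsum' hc1 hc2 hlow hup hconj
  set w := 4 * q ^ 2 - 8 * s ^ 2
  interval_cases y <;> interval_cases x
  · exact not_sq (2 * w) 14 3 (by norm_num) (by norm_num) (by norm_num)
      (by push_cast at *; linarith)
  · exact not_sq (2 * w) 56 7 (by norm_num) (by norm_num) (by norm_num)
      (by push_cast at *; linarith)
  · exact not_sq (2 * w) 46 6 (by norm_num) (by norm_num) (by norm_num)
      (by push_cast at *; linarith)
  · exact not_sq (2 * w) 14 3 (by norm_num) (by norm_num) (by norm_num)
      (by push_cast at *; linarith)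
  · exact not_sq (2 * w) 128 11 (by norm_num) (by norm_num) (by norm_num)
      (by push_cast at *; linarith)
  · exact absurd (hx3 rfl) (by norm_num)
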